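/- Let G be a finite group, p a prime, and χ an irreducible complex character of G such that χ(x) is a root of unity for every p-singular element x of G. If S is a Sylow p-subgroup of G, then χ(1)^2 ≡ 1 (mod |S|); in particular, p does not divide χ(1). -/

import Mathlib

open CategoryTheory Module

/-- An endomorphism `f` of finite order is diagonalizable with roots of unity as eigenvalues, so the
traces of its powers are the power sums of its eigenvalues. -/
theorem LinearMap.exists_trace_pow_eq_sum {V : Type*} [AddCommGroup V] [Module ℂ V]
    [FiniteDimensional ℂ V] (f : End ℂ V) {n : ℕ} (hn : 0 < n) (hf : f ^ n = 1) :
    ∃ (s : Finset ℂ) (d : ℂ → ℕ), (∀ μ ∈ s, μ ^ n = 1) ∧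
      ∀ k : ℕ, LinearMap.trace ℂ V (f ^ k) = ∑ μ ∈ s, (d μ : ℂ) * μ ^ k := by
  have hss : f.IsSemisimple := by
    apply Module.End.isSemisimple_of_squarefree_aeval_eq_zero
      (p := (Polynomial.X ^ n - 1 : Polynomial ℂ))
    · have hsep := (Polynomial.separable_X_pow_sub_C (F := ℂ) (n := n) 1
        (by exact_mod_cast hn.ne') one_ne_zero)
      simpa using hsep.squarefree
    · simp [hf]
  have htop : ⨆ μ : ℂ, f.eigenspace μ = ⊤ := by
    rw [← Module.End.iSup_maxGenEigenspace_eq_top f]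
    exact iSup_congr fun μ ↦ (hss.isFinitelySemisimple.maxGenEigenspace_eq_eigenspace μ).symm
  have hint : DirectSum.IsInternal fun μ : ℂ ↦ f.eigenspace μ :=
    (DirectSum.isInternal_submodule_iff_iSupIndep_and_iSup_eq_top _).2
      ⟨f.eigenspaces_iSupIndep, htop⟩
  have hfin : {μ : ℂ | f.eigenspace μ ≠ ⊥}.Finite :=
    WellFoundedGT.finite_ne_bot_of_iSupIndep f.eigenspaces_iSupIndep
  have hpow (k : ℕ) (μ : ℂ) (v : V) (hv : v ∈ f.eigenspace μ) : (f ^ k) v = μ ^ k • v := by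
    have hv' := Module.End.mem_eigenspace_iff.1 hv
    induction k with
    | zero => simp
    | succ k ih => rw [pow_succ, Module.End.mul_apply, hv', map_smul, ih, smul_smul, pow_succ']
  refine ⟨hfin.toFinset, fun μ ↦ finrank ℂ (f.eigenspace μ), fun μ hμ ↦ ?_, fun k ↦ ?_⟩
  · obtain ⟨v, hv, hv0⟩ := (Submodule.ne_bot_iff _).1 (hfin.mem_toFinset.1 hμ)
    have h := hpow n μ v hv
    rw [hf, Module.End.one_apply] at h
    exact smul_left_injective ℂ hv0 (by simp [← h])
  · have hmaps (μ : ℂ) : Set.MapsTo (f ^ k) (f.eigenspace μ) (f.eigenspace μ) := fun v hv ↦ by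
      rw [SetLike.mem_coe, hpow k μ v hv]
      exact Submodule.smul_mem _ _ hv
    rw [LinearMap.trace_eq_sum_trace_restrict' hint hfin hmaps]
    refine Finset.sum_congr rfl fun μ _ ↦ ?_
    have h : (f ^ k).restrict (hmaps μ) = μ ^ k • (1 : End ℂ (f.eigenspace μ)) := by
      ext v
      exact hpow k μ v v.2
    rw [h, map_smul, LinearMap.trace_one, smul_eq_mul, mul_comm]

namespace FDRep

variable {G : Type} [Group G] [Fintype G] (V : FDRep ℂ G)

/-- Character values are algebraic integers. -/
theorem isIntegral_character (g : G) : IsIntegral ℤ (V.character g) := by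
  obtain ⟨s, d, hs, htr⟩ := LinearMap.exists_trace_pow_eq_sum (V.ρ g) (orderOf_pos g)
    (by rw [← map_pow, pow_orderOf_eq_one, map_one])
  rw [character, ← pow_one (V.ρ g), htr]
  refine IsIntegral.sum _ fun μ hμ ↦ IsIntegral.mul (isIntegral_natCast _) (.pow ?_ 1)
  exact .of_pow (orderOf_pos g) (by rw [hs μ hμ]; exact isIntegral_one)

theorem character_inv (g : G) : V.character g⁻¹ = starRingEnd ℂ (V.character g) := by
  obtain ⟨s, d, hs, htr⟩ := LinearMap.exists_trace_pow_eq_sum (V.ρ g) (orderOf_pos g)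
    (by rw [← map_pow, pow_orderOf_eq_one, map_one])
  have hinv : g⁻¹ = g ^ (orderOf g - 1) :=
    inv_eq_of_mul_eq_one_right (by rw [mul_pow_sub_one (orderOf_pos g).ne', pow_orderOf_eq_one])
  have h1 := htr 1
  rw [pow_one] at h1
  rw [character, character, hinv, map_pow, htr, h1, map_sum]
  refine Finset.sum_congr rfl fun μ hμ ↦ ?_
  have hnorm : ‖μ‖ = 1 := Complex.norm_eq_one_of_pow_eq_one (hs μ hμ) (orderOf_pos g).ne'
  rw [map_mul, map_natCast, pow_one, ← Complex.inv_eq_conj hnorm]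
  congr 1
  exact eq_inv_of_mul_eq_one_right (by rw [mul_pow_sub_one (orderOf_pos g).ne', hs μ hμ])

variable [Simple V]

theorem sum_character_mul_character_inv :
    ∑ g : G, V.character g * V.character g⁻¹ = Nat.card G := by
  have hcard : (Nat.card G : ℂ) ≠ 0 := by exact_mod_cast Nat.card_pos.ne'
  let _ := invertibleOfNonzero hcard
  have h := char_orthonormal V V
  rw [if_pos ⟨Iso.refl V⟩, inv_mul_eq_iff_eq_mul₀ hcard, mul_one] at h
  exact h

/-- Schur's lemma for unbundled endomorphisms. -/
theorem exists_eq_smul_one_of_commute (T : End ℂ V) (hT : ∀ g, Commute T (V.ρ g)) :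
    ∃ c : ℂ, T = c • 1 := by
  have hcard : (Nat.card G : ℂ) ≠ 0 := by exact_mod_cast Nat.card_pos.ne'
  let _ := invertibleOfNonzero hcard
  have h := Representation.card_inv_mul_sum_char_mul_char_eq_finrank V.ρ V.ρ
  have h' : ∑ g : G, Representation.character V.ρ g * Representation.character V.ρ g⁻¹ =
    Nat.card G := V.sum_character_mul_character_inv
  rw [h', inv_mul_cancel₀ hcard] at h
  have h1 : finrank ℂ (Representation.IntertwiningMap V.ρ V.ρ) = 1 := by exact_mod_cast h.symm
  have hne : (1 : Representation.IntertwiningMap V.ρ V.ρ) ≠ 0 := by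
    have := Module.nontrivial_of_finrank_pos (h1 ▸ one_pos)
    exact one_ne_zero
  obtain ⟨c, hc⟩ := (finrank_eq_one_iff_of_nonzero' _ hne).1 h1 ⟨T, hT⟩
  exact ⟨c, (congrArg (·.toLinearMap) hc).symm⟩

/-- The degree of an irreducible complex character divides the order of the group. -/
theorem finrank_dvd_card : finrank ℂ V ∣ Nat.card G := by
  let T : End ℂ V := ∑ g : G, V.character g⁻¹ • V.ρ g
  obtain ⟨c, hc⟩ := V.exists_eq_smul_one_of_commute T fun h ↦ by
    change T * V.ρ h = V.ρ h * T
    simp only [T, Finset.sum_mul, Finset.mul_sum, smul_mul_assoc, mul_smul_comm, ← map_mul]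
    refine Fintype.sum_equiv (MulAut.conj h⁻¹).toEquiv _ _ fun g ↦ ?_
    have hconj := V.char_conj g⁻¹ h⁻¹
    simp only [inv_inv] at hconj
    simp [mul_assoc, ← hconj]
  have htrace : c * finrank ℂ V = Nat.card G := by
    rw [← V.sum_character_mul_character_inv, ← smul_eq_mul, ← LinearMap.trace_one, ← map_smul, ← hc]
    simp [T, character, mul_comm]
  let A := integralClosure ℤ ℂ
  let z : MonoidAlgebra A G :=
    ∑ g : G, MonoidAlgebra.single g ⟨V.character g⁻¹, V.isIntegral_character g⁻¹⟩
  have hz : MonoidAlgebra.lift A (End ℂ V) G V.ρ z = T := by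
    rw [map_sum]
    refine Finset.sum_congr rfl fun g _ ↦ ?_
    rw [MonoidAlgebra.lift_single]
    rfl
  have hTint : IsIntegral A (algebraMap ℂ (End ℂ V) c) := by
    rw [Algebra.algebraMap_eq_smul_one, ← hc, ← hz]
    exact (IsIntegral.of_finite A z).map _
  have hd : finrank ℂ V ≠ 0 := by
    intro h0
    rw [h0, Nat.cast_zero, mul_zero] at htrace
    exact Nat.card_pos.ne (by exact_mod_cast htrace)
  have : Nontrivial V := Module.nontrivial_of_finrank_pos (R := ℂ) (Nat.pos_of_ne_zero hd)
  have hcA : IsIntegral A c :=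
    (isIntegral_algebraMap_iff (FaithfulSMul.algebraMap_injective ℂ (End ℂ V))).1 hTint
  have hcint : IsIntegral ℤ c := isIntegral_trans c hcA
  have hdC : (finrank ℂ V : ℂ) ≠ 0 := by exact_mod_cast hd
  have hcq : c = algebraMap ℚ ℂ (Nat.card G / finrank ℂ V) := by
    rw [eq_div_of_mul_eq hdC htrace]
    simp
  rw [hcq, isIntegral_algebraMap_iff (algebraMap ℚ ℂ).injective] at hcint
  obtain ⟨m, hm⟩ := IsIntegrallyClosed.isIntegral_iff.1 hcint
  rw [eq_div_iff (by exact_mod_cast hd), eq_intCast] at hm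
  refine Int.natCast_dvd_natCast.1 ⟨m, ?_⟩
  rw [mul_comm]
  exact_mod_cast hm.symm

end FDRep

/-- **Lemma 2.3(a)** (Navarro–Robinson), first part. If the irreducible complex character of
`V` takes root of unity values on all `p`-singular elements of the finite group `G`, and `S`
is a Sylow `p`-subgroup, then `χ(1)² ≡ 1 (mod |S|)`; in particular `p` does not divide the
degree `χ(1)`. -/
theorem stmt_3 {G : Type} [Group G] [Fintype G] (p : ℕ) (hp : p.Prime)
    (V : FDRep ℂ G) (hV : Simple V)
    (hroot : ∀ x : G, p ∣ orderOf x → ∃ n : ℕ, 0 < n ∧ V.character x ^ n = 1)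
    (S : Sylow p G) :
    ((finrank ℂ V : ℤ) ^ 2 ≡ 1 [ZMOD (Nat.card (S : Subgroup G))]) ∧
      ¬ p ∣ finrank ℂ V := by
  classical
  have := Fact.mk hp
  have hmod : (finrank ℂ V : ℤ) ^ 2 ≡ 1 [ZMOD (Nat.card (S : Subgroup G))] := by
    have hcard : (Nat.card S : ℂ) ≠ 0 := by exact_mod_cast Nat.card_pos.ne'
    let _ := invertibleOfNonzero hcard
    let σ : Representation ℂ S V := V.ρ.comp (S : Subgroup G).subtype
    have h := Representation.card_inv_mul_sum_char_mul_char_eq_finrank σ σ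
    rw [inv_mul_eq_iff_eq_mul₀ hcard] at h
    have hone (s : (S : Subgroup G)) (hs : s ≠ 1) : σ.character s * σ.character s⁻¹ = 1 := by
      obtain ⟨n, hn, hχ⟩ := hroot s (by
        rw [Subgroup.orderOf_coe]
        obtain ⟨k, hk⟩ := IsPGroup.iff_orderOf.1 S.isPGroup' s
        rw [hk]
        refine dvd_pow_self p ?_
        rintro rfl
        exact hs (orderOf_eq_one_iff.1 (by simpa using hk)))
      have hnorm := Complex.norm_eq_one_of_pow_eq_one hχ hn.ne'
      change V.character s * V.character (s : G)⁻¹ = 1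
      rw [V.character_inv, Complex.mul_conj, Complex.normSq_eq_norm_sq, hnorm]
      simp
    rw [← Finset.add_sum_erase _ _ (Finset.mem_univ 1),
      Finset.sum_congr rfl fun s hs ↦ hone s (Finset.ne_of_mem_erase hs)] at h
    rw [inv_one, Representation.char_one, Finset.sum_const,
      Finset.card_erase_of_mem (Finset.mem_univ _), Finset.card_univ, ← Nat.card_eq_fintype_card,
      nsmul_one, Nat.cast_pred Nat.card_pos] at h
    refine Int.ModEq.symm ((Int.modEq_iff_dvd).2
      ⟨(finrank ℂ (Representation.IntertwiningMap σ σ) : ℤ) - 1, ?_⟩)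
    have h' : ((finrank ℂ V : ℤ) : ℂ) ^ 2 - 1 = ((Nat.card S : ℤ) : ℂ) *
      (((finrank ℂ (Representation.IntertwiningMap σ σ) : ℤ) : ℂ) - 1) := by
      push_cast
      linear_combination h
    exact_mod_cast h'
  refine ⟨hmod, fun hdvd ↦ ?_⟩
  have hpG : p ∣ Nat.card G := hdvd.trans V.finrank_dvd_card
  have hpS : p ∣ Nat.card S := S.dvd_card_of_dvd_card hpG
  have h1 := (Int.modEq_iff_dvd.1 hmod)
  have h2 : (p : ℤ) ∣ 1 := by
    have h3 : (p : ℤ) ∣ (finrank ℂ V : ℤ) ^ 2 :=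
      dvd_pow (Int.natCast_dvd_natCast.2 hdvd) two_ne_zero
    have h4 := (Int.natCast_dvd_natCast.2 hpS).trans h1
    exact (dvd_sub_left h3).1 h4
  exact hp.one_lt.ne' (by simpa using Int.eq_one_of_dvd_one (by positivity) h2)
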